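/- arXiv:0806.1681 — 2 statements merged into one kernel-verified Lean document; each statement's English description precedes it below -/
import Mathlib

section
/- Let D, n, ℓ ≥ 1 with n > Dℓ/2, let η be a real n × ℓ matrix, let t_1, …, t_n be nonnegative reals with t_1 + ⋯ + t_n = 1, let m_1, …, m_n be real numbers, and let u_1, …, u_n ∈ ℝ^D satisfy Σ_{i=1}^n t_i η_{ik} u_i = 0 for every k. Assume the ℓ × ℓ matrix M(t), with (M(t))_{kr} = Σ_i t_i η_{ik} η_{ir}, is positive definite and that a := Σ_{i=1}^n t_i (‖u_i‖² + m_i²) > 0. Then ∫_{(ℝ^D)^ℓ} (Σ_{i=1}^n t_i (‖u_i + Σ_{k=1}^ℓ η_{ik} s_k‖² + m_i²))^{−n} ds = C_{Dℓ,n} · det(M(t))^{−D/2} · a^{Dℓ/2 − n}, where C_{Dℓ,n} := ∫_{ℝ^{Dℓ}} (1 + ‖x‖²)^{−n} dx. -/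
open MeasureTheory

section GramExpansion

variable {ι κ E : Type*} [Fintype ι] [Fintype κ] [NormedAddCommGroup E] [InnerProductSpace ℝ E]

lemma norm_sq_sum_smul (c : κ → ℝ) (s : κ → E) :
    ‖∑ k, c k • s k‖ ^ 2 = ∑ k, ∑ r, c k * c r * inner ℝ (s k) (s r) := by
  rw [← real_inner_self_eq_norm_sq, sum_inner]
  simp_rw [inner_sum, real_inner_smul_left, real_inner_smul_right, mul_assoc]

lemma sum_mul_norm_sq_sum_smul (t : ι → ℝ) (A : Matrix ι κ ℝ) (s : κ → E) :
    ∑ i, t i * ‖∑ k, A i k • s k‖ ^ 2 =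
      ∑ k, ∑ r, (∑ i, t i * A i k * A i r) * inner ℝ (s k) (s r) := by
  simp_rw [norm_sq_sum_smul, Finset.mul_sum, Finset.sum_mul]
  rw [Finset.sum_comm]
  refine Finset.sum_congr rfl fun k _ => ?_
  rw [Finset.sum_comm]
  simp_rw [mul_assoc]

/-- Completing the square: the linear term vanishes under the constraint `hu` on `u`. -/
lemma sum_mul_norm_add_sq_of_sum_smul_eq_zero (t : ι → ℝ) (A : Matrix ι κ ℝ) (m : ι → ℝ)
    (u : ι → E) (hu : ∀ k, ∑ i, (t i * A i k) • u i = 0) (s : κ → E) :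
    ∑ i, t i * (‖u i + ∑ k, A i k • s k‖ ^ 2 + m i ^ 2) =
      ∑ i, t i * (‖u i‖ ^ 2 + m i ^ 2) + ∑ i, t i * ‖∑ k, A i k • s k‖ ^ 2 := by
  have hcross : ∑ i, t i * inner ℝ (u i) (∑ k, A i k • s k) = 0 := by
    simp_rw [inner_sum, real_inner_smul_right, Finset.mul_sum]
    rw [Finset.sum_comm]
    refine Finset.sum_eq_zero fun k _ => ?_
    have h := congrArg (fun v => inner ℝ v (s k)) (hu k)
    simpa only [sum_inner, real_inner_smul_left, inner_zero_left, mul_assoc] using h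
  have hexp : ∀ i, t i * (‖u i + ∑ k, A i k • s k‖ ^ 2 + m i ^ 2) =
      t i * (‖u i‖ ^ 2 + m i ^ 2) + t i * ‖∑ k, A i k • s k‖ ^ 2 +
        2 * (t i * inner ℝ (u i) (∑ k, A i k • s k)) := fun i => by
    rw [norm_add_sq_real]
    ring
  simp_rw [hexp, Finset.sum_add_distrib, ← Finset.mul_sum, hcross]
  ring

end GramExpansion

open scoped ComplexOrder MatrixOrder Matrix.Norms.L2Operator in
lemma Matrix.PosDef.exists_transpose_mul_self {κ : Type*} [Fintype κ] [DecidableEq κ]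
    {M : Matrix κ κ ℝ} (hM : M.PosDef) : ∃ B : Matrix κ κ ℝ, M = B.transpose * B := by
  obtain ⟨B, hB⟩ := CStarAlgebra.nonneg_iff_eq_star_mul_self.mp hM.posSemidef.nonneg
  exact ⟨B, by simpa [Matrix.star_eq_conjTranspose] using hB⟩

section ChangeOfVariables

/-- Change of variables under an invertible linear map; no integrability is needed. -/
lemma integral_comp_linearMap {X F : Type*} [NormedAddCommGroup X] [NormedSpace ℝ X]
    [MeasurableSpace X] [BorelSpace X] [FiniteDimensional ℝ X] [NormedAddCommGroup F]
    [NormedSpace ℝ F] (μ : Measure X) [μ.IsAddHaarMeasure] {T : X →ₗ[ℝ] X}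
    (hT : LinearMap.det T ≠ 0) (g : X → F) :
    ∫ x, g (T x) ∂μ = |(LinearMap.det T)⁻¹| • ∫ x, g x ∂μ := by
  have hemb : MeasurableEmbedding T :=
    (LinearMap.equivOfDetNeZero T hT).toContinuousLinearEquiv.toHomeomorph.measurableEmbedding
  rw [← hemb.integral_map, Measure.map_linearMap_addHaar_eq_smul_addHaar μ hT,
    integral_smul_measure, ENNReal.toReal_ofReal (abs_nonneg _)]

variable {ι κ ν : Type*}

/-- Exchange of the family index and the coordinate index. -/
noncomputable def familySwap (ι κ : Type*) :
    (κ → EuclideanSpace ℝ ι) ≃ₗ[ℝ] (ι → κ → ℝ) where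
  toFun s i k := s k i
  invFun f k := WithLp.toLp 2 fun i => f i k
  map_add' _ _ := rfl
  map_smul' _ _ := rfl
  left_inv _ := rfl
  right_inv _ := rfl

@[simp]
lemma familySwap_apply (s : κ → EuclideanSpace ℝ ι) (i : ι) (k : κ) :
    familySwap ι κ s i k = s k i := rfl

@[simp]
lemma familySwap_symm_apply (f : ι → κ → ℝ) (k : κ) (i : ι) :
    (familySwap ι κ).symm f k i = f i k := rfl

/-- Concatenation of the coordinates of a family of Euclidean vectors. -/
noncomputable def familyFlatten (e : ι × κ ≃ ν) :
    (κ → EuclideanSpace ℝ ι) ≃ₗ[ℝ] EuclideanSpace ℝ ν where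
  toFun s := WithLp.toLp 2 fun p => s (e.symm p).2 (e.symm p).1
  invFun x k := WithLp.toLp 2 fun i => x (e (i, k))
  map_add' _ _ := rfl
  map_smul' _ _ := rfl
  left_inv s := by
    ext k i
    simp
  right_inv x := by
    ext p
    simp

@[simp]
lemma familyFlatten_apply (e : ι × κ ≃ ν) (s : κ → EuclideanSpace ℝ ι) (p : ν) :
    familyFlatten e s p = s (e.symm p).2 (e.symm p).1 := rfl

variable [Fintype κ]

/-- The action of a matrix on families of Euclidean vectors, entrywise in the family index. -/
noncomputable def Matrix.mulFamily (B : Matrix κ κ ℝ) :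
    (κ → EuclideanSpace ℝ ι) →ₗ[ℝ] (κ → EuclideanSpace ℝ ι) where
  toFun s j := ∑ k, B j k • s k
  map_add' s s' := by
    ext1 j
    simp [smul_add, Finset.sum_add_distrib]
  map_smul' c s := by
    ext1 j
    simp [Finset.smul_sum, smul_comm c]

@[simp]
lemma Matrix.mulFamily_apply (B : Matrix κ κ ℝ) (s : κ → EuclideanSpace ℝ ι) (j : κ) :
    B.mulFamily s j = ∑ k, B j k • s k := rfl

variable [Fintype ι]

lemma Matrix.det_mulFamily [DecidableEq κ] (B : Matrix κ κ ℝ) :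
    LinearMap.det (B.mulFamily (ι := ι)) = B.det ^ Fintype.card ι := by
  rw [← LinearMap.det_conj _ (familySwap ι κ)]
  have h : (familySwap ι κ : _ →ₗ[ℝ] _) ∘ₗ B.mulFamily (ι := ι) ∘ₗ
      ((familySwap ι κ).symm : _ →ₗ[ℝ] _) =
      LinearMap.pi fun i => Matrix.toLin' B ∘ₗ
        LinearMap.proj (R := ℝ) (φ := fun _ : ι => κ → ℝ) i := by
    refine LinearMap.ext fun f => funext fun i => funext fun j => ?_
    simp [Matrix.mulVec, dotProduct]
  rw [h, LinearMap.det_pi]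
  simp

variable [Fintype ν]

lemma norm_sq_familyFlatten (e : ι × κ ≃ ν) (s : κ → EuclideanSpace ℝ ι) :
    ‖familyFlatten e s‖ ^ 2 = ∑ k, ‖s k‖ ^ 2 := by
  simp_rw [EuclideanSpace.norm_sq_eq]
  rw [← e.sum_comp, Fintype.sum_prod_type_right]
  simp

lemma measurePreserving_familyFlatten (e : ι × κ ≃ ν) :
    MeasurePreserving (familyFlatten e) := by
  have hmeas : Measurable (fun (s : κ → EuclideanSpace ℝ ι) (p : ν) =>
      s (e.symm p).2 (e.symm p).1) := by
    fun_prop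
  refine (PiLp.volume_preserving_toLp ν).comp ⟨hmeas, ?_⟩
  symm
  refine Measure.pi_eq fun S hS => ?_
  have hpre : (fun (s : κ → EuclideanSpace ℝ ι) (p : ν) => s (e.symm p).2 (e.symm p).1) ⁻¹'
      Set.univ.pi S =
      Set.univ.pi fun k => WithLp.ofLp ⁻¹' Set.univ.pi fun i => S (e (i, k)) := by
    ext s
    simp only [Set.mem_preimage, Set.mem_univ_pi]
    exact ⟨fun h k i => by simpa using h (e (i, k)),
      fun h p => by simpa using h (e.symm p).2 (e.symm p).1⟩
  rw [Measure.map_apply hmeas (MeasurableSet.univ_pi hS), hpre, volume_pi_pi]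
  simp_rw [(PiLp.volume_preserving_ofLp ι).measure_preimage
    (MeasurableSet.univ_pi fun i => hS (e (i, _))).nullMeasurableSet, volume_pi_pi]
  rw [← e.prod_comp, Fintype.prod_prod_type_right]

lemma integral_add_sum_norm_sq_rpow (e : ι × κ ≃ ν) {a : ℝ} (ha : 0 < a) (p : ℝ) :
    ∫ s : κ → EuclideanSpace ℝ ι, (a + ∑ k, ‖s k‖ ^ 2) ^ p =
      (∫ x : EuclideanSpace ℝ ν, (1 + ‖x‖ ^ 2) ^ p) * a ^ ((Fintype.card ν : ℝ) / 2 + p) := by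
  have hemb : MeasurableEmbedding (familyFlatten e) :=
    (familyFlatten e).toContinuousLinearEquiv.toHomeomorph.measurableEmbedding
  simp_rw [← norm_sq_familyFlatten e]
  rw [(measurePreserving_familyFlatten e).integral_comp hemb (fun x => (a + ‖x‖ ^ 2) ^ p)]
  have hscale := Measure.integral_comp_smul (volume : Measure (EuclideanSpace ℝ ν))
    (fun x => (a + ‖x‖ ^ 2) ^ p) √a
  have hpt : ∀ x : EuclideanSpace ℝ ν,
      (a + ‖√a • x‖ ^ 2) ^ p = a ^ p * (1 + ‖x‖ ^ 2) ^ p := fun x => by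
    rw [norm_smul, mul_pow, Real.norm_eq_abs, sq_abs, Real.sq_sqrt ha.le,
      ← Real.mul_rpow ha.le (by positivity), mul_add, mul_one]
  have hpow : √a ^ Fintype.card ν = a ^ ((Fintype.card ν : ℝ) / 2) := by
    rw [Real.sqrt_eq_rpow, ← Real.rpow_natCast, ← Real.rpow_mul ha.le]
    ring_nf
  have hpos : 0 < a ^ ((Fintype.card ν : ℝ) / 2) := Real.rpow_pos_of_pos ha _
  simp_rw [hpt, integral_const_mul] at hscale
  rw [finrank_euclideanSpace, hpow, abs_of_pos (inv_pos.2 hpos), smul_eq_mul,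
    eq_inv_mul_iff_mul_eq₀ hpos.ne'] at hscale
  rw [← hscale, Real.rpow_add ha]
  ring

end ChangeOfVariables

/-- Lemma 3.2 of the paper in convergent Euclidean form: with `t` in the simplex,
`u` satisfying the constraint `Σ_i t_i η_{ik} u_i = 0`, `M(t)` positive definite and
`a = Σ_i t_i (‖u_i‖² + m_i²) > 0`,
`∫_{(ℝ^D)^ℓ} (Σ_i t_i (‖u_i + Σ_k η_{ik} s_k‖² + m_i²))^{-n} ds
  = C_{Dℓ,n} · det(M(t))^{-D/2} · a^{Dℓ/2 - n}`. -/
theorem momentum_integral_parametric (D n l : ℕ) (hD : 1 ≤ D) (hn : 1 ≤ n) (hl : 1 ≤ l)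
    (hconv : (D * l : ℝ) / 2 < n)
    (η : Matrix (Fin n) (Fin l) ℝ) (t : Fin n → ℝ)
    (ht : ∀ i, 0 ≤ t i) (htsum : ∑ i, t i = 1)
    (m : Fin n → ℝ) (u : Fin n → EuclideanSpace ℝ (Fin D))
    (hu : ∀ k, ∑ i, (t i * η i k) • u i = 0)
    (hM : (Matrix.of fun k r : Fin l => ∑ i, t i * η i k * η i r).PosDef)
    (ha : 0 < ∑ i, t i * (‖u i‖ ^ 2 + m i ^ 2)) :
    ∫ s : Fin l → EuclideanSpace ℝ (Fin D),
        (∑ i, t i * (‖u i + ∑ k, η i k • s k‖ ^ 2 + m i ^ 2)) ^ (-(n : ℝ)) =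
      (∫ x : EuclideanSpace ℝ (Fin (D * l)), (1 + ‖x‖ ^ 2) ^ (-(n : ℝ))) *
        (Matrix.of fun k r : Fin l => ∑ i, t i * η i k * η i r).det ^ (-(D : ℝ) / 2) *
        (∑ i, t i * (‖u i‖ ^ 2 + m i ^ 2)) ^ ((D * l : ℝ) / 2 - n) := by
  set M := Matrix.of fun k r : Fin l => ∑ i, t i * η i k * η i r with hMdef
  set a := ∑ i, t i * (‖u i‖ ^ 2 + m i ^ 2)
  obtain ⟨B, hB⟩ := hM.exists_transpose_mul_self
  have hdet : M.det = B.det ^ 2 := by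
    rw [hB, Matrix.det_mul, Matrix.det_transpose, sq]
  have hBdet : B.det ≠ 0 := fun h => hM.det_pos.ne' (by rw [hdet, h]; simp)
  have hquad : ∀ s : Fin l → EuclideanSpace ℝ (Fin D),
      ∑ i, t i * (‖u i + ∑ k, η i k • s k‖ ^ 2 + m i ^ 2) =
        a + ∑ j, ‖B.mulFamily s j‖ ^ 2 := fun s => by
    have hBsq := sum_mul_norm_sq_sum_smul (fun _ => 1) B s
    simp only [one_mul] at hBsq
    rw [sum_mul_norm_add_sq_of_sum_smul_eq_zero t η m u hu, sum_mul_norm_sq_sum_smul,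
      show ∑ j, ‖B.mulFamily s j‖ ^ 2 = _ from hBsq]
    refine congrArg (a + ·) (Finset.sum_congr rfl fun k _ => Finset.sum_congr rfl fun r _ => ?_)
    have h := congrFun (congrFun hB k) r
    simp only [hMdef, Matrix.of_apply, Matrix.mul_apply, Matrix.transpose_apply] at h
    rw [h]
  have hfac : |(B.det ^ D)⁻¹| = M.det ^ (-(D : ℝ) / 2) := by
    rw [hdet, ← sq_abs, ← Real.rpow_natCast |B.det| 2, ← Real.rpow_mul (abs_nonneg _), abs_inv,
      abs_pow, ← Real.rpow_natCast, ← Real.rpow_neg (abs_nonneg _)]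
    congr 1
    push_cast
    ring
  simp_rw [hquad]
  have hcov := integral_comp_linearMap volume (T := B.mulFamily (ι := Fin D))
    (by rw [Matrix.det_mulFamily]; exact pow_ne_zero _ hBdet)
    (fun s => (a + ∑ j, ‖s j‖ ^ 2) ^ (-(n : ℝ)))
  rw [hcov,
    integral_add_sum_norm_sq_rpow finProdFinEquiv ha, Matrix.det_mulFamily, Fintype.card_fin,
    Fintype.card_fin, hfac, smul_eq_mul, Nat.cast_mul, ← sub_eq_add_neg]
  ring
end

section
/- Let D, n, ℓ ≥ 1 with n > Dℓ/2, let η be a real n × ℓ matrix, let m_1, …, m_n be real numbers, and let u_1, …, u_n ∈ ℝ^D satisfy η_{ik} u_i = 0 for all i, k (so that the constraint Σ_i t_i η_{ik} u_i = 0 holds for every t) and ‖u_i‖² + m_i² > 0 for every i. Assume that the matrix M(t), with (M(t))_{kr} = Σ_i t_i η_{ik} η_{ir}, is positive definite for every t in the open simplex {t_i > 0, Σ t_i = 1}. Then ∫_{(ℝ^D)^ℓ} ∏_{i=1}^n (‖u_i + Σ_{k=1}^ℓ η_{ik} s_k‖² + m_i²)^{−1} ds = (n−1)! · C_{Dℓ,n}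 · ∫_{Σ_{n−1}} det(M(t))^{−D/2} · (Σ_{i=1}^n t_i (‖u_i‖² + m_i²))^{Dℓ/2 − n} dt_1 ⋯ dt_{n−1}, where t_n := 1 − (t_1 + ⋯ + t_{n−1}) and C_{Dℓ,n} := ∫_{ℝ^{Dℓ}} (1 + ‖x‖²)^{−n} dx. -/
open MeasureTheory

/-- The Gamma integral `∫₀^∞ xⁿ e^{-ax} dx = n! / a^{n+1}`, as a lower Lebesgue integral. -/
theorem lintegral_pow_mul_exp_neg_mul_Ioi (n : ℕ) {a : ℝ} (ha : 0 < a) :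
    ∫⁻ x in Set.Ioi (0 : ℝ), ENNReal.ofReal (x ^ n * Real.exp (-(a * x))) =
      ENNReal.ofReal (n.factorial * a ^ (-(n + 1 : ℝ))) := by
  have hint : IntegrableOn (fun x : ℝ => x ^ n * Real.exp (-(a * x))) (Set.Ioi 0) := by
    simpa using integrableOn_rpow_mul_exp_neg_mul_rpow (s := n) (p := 1) (b := a)
      (by linarith [n.cast_nonneg (α := ℝ)]) one_pos ha
  rw [← ofReal_integral_eq_lintegral_ofReal hint]
  · have h := Real.integral_rpow_mul_exp_neg_mul_Ioi (a := n + 1) (r := a) (by positivity) ha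
    simp only [add_sub_cancel_right, Real.rpow_natCast] at h
    rw [h, Real.Gamma_nat_eq_factorial, Real.rpow_neg ha.le, one_div, Real.inv_rpow ha.le, mul_comm]
  · filter_upwards [ae_restrict_mem measurableSet_Ioi] with x hx
    have : (0 : ℝ) < x := hx
    positivity

/-- The product of the exponential integrals `∫₀^∞ e^{-aᵢx} dx`, as an integral over an orthant. -/
theorem lintegral_orthant_exp_neg_sum {ι : Type*} [Fintype ι] {a : ι → ℝ} (ha : ∀ i, 0 < a i) :
    ∫⁻ x in {x : ι → ℝ | ∀ i, 0 < x i}, ENNReal.ofReal (Real.exp (-∑ i, a i * x i)) =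
      ENNReal.ofReal (∏ i, (a i)⁻¹) := by
  have hset : {x : ι → ℝ | ∀ i, 0 < x i} = Set.univ.pi fun _ => Set.Ioi 0 := by
    ext; simp
  have hint (i : ι) : Integrable (fun x : ℝ => Real.exp (-(a i * x)))
      (volume.restrict (Set.Ioi 0)) := by
    simpa [IntegrableOn] using exp_neg_integrableOn_Ioi 0 (ha i)
  simp_rw [← Finset.sum_neg_distrib, Real.exp_sum]
  rw [hset, volume_pi, Measure.restrict_pi_pi,
    ← ofReal_integral_eq_lintegral_ofReal (Integrable.fintype_prod hint)
      (.of_forall fun x => by positivity),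
    integral_fintype_prod_eq_prod fun i x => Real.exp (-(a i * x))]
  congr 1
  refine Finset.prod_congr rfl fun i _ => ?_
  have h := integral_exp_mul_Ioi (neg_lt_zero.2 (ha i)) 0
  simp only [neg_mul, mul_zero, Real.exp_zero] at h
  rw [h, neg_div_neg_eq, one_div]

/-- Lebesgue measure on `ℝ^ι` scales by `r ^ card ι` under dilation by `r > 0`. -/
theorem lintegral_comp_smul_pi {ι : Type*} [Fintype ι] {f : (ι → ℝ) → ENNReal}
    (hf : Measurable f) {r : ℝ} (hr : 0 < r) :
    ∫⁻ x, f x = ENNReal.ofReal (r ^ Fintype.card ι) * ∫⁻ x, f (r • x) := by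
  rw [← lintegral_map hf (measurable_const_smul r), Measure.map_addHaar_smul _ hr.ne',
    lintegral_smul_measure, Module.finrank_fintype_fun_eq_card, smul_eq_mul, ← mul_assoc,
    ← ENNReal.ofReal_mul (by positivity), abs_of_pos (by positivity),
    mul_inv_cancel₀ (by positivity), ENNReal.ofReal_one, one_mul]

theorem lintegral_fin_snoc {n : ℕ} {f : (Fin (n + 1) → ℝ) → ENNReal} (hf : Measurable f) :
    ∫⁻ x, f x = ∫⁻ y : Fin n → ℝ, ∫⁻ a : ℝ, f (Fin.snoc y a) := by
  have h := (volume_preserving_piFinSuccAbove (fun _ : Fin (n + 1) => ℝ) (Fin.last n)).symm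
  rw [← h.lintegral_comp hf, Measure.volume_eq_prod, lintegral_prod_symm]
  · simp [MeasurableEquiv.piFinSuccAbove, Fin.insertNthEquiv, Fin.insertNth_last']
  · exact (hf.comp h.measurable).aemeasurable

theorem measurable_fin_snoc {n : ℕ} {α : Type*} [MeasurableSpace α] {y : α → Fin n → ℝ}
    {a : α → ℝ} (hy : Measurable y) (ha : Measurable a) :
    Measurable fun x => (Fin.snoc (y x) (a x) : Fin (n + 1) → ℝ) := by
  refine measurable_pi_iff.2 fun i => ?_
  induction i using Fin.lastCases with
  | last => simpa using ha
  | cast i => simpa using measurable_pi_iff.1 hy i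

/-- Integration over the positive orthant in projective coordinates `x = r • (t, 1 - ∑ t)`. -/
theorem lintegral_orthant_eq_lintegral_simplex {n : ℕ} {f : (Fin (n + 1) → ℝ) → ENNReal}
    (hf : Measurable f) :
    ∫⁻ x in {x | ∀ i, 0 < x i}, f x =
      ∫⁻ t in {t : Fin n → ℝ | (∀ i, 0 < t i) ∧ ∑ i, t i < 1}, ∫⁻ r in Set.Ioi (0 : ℝ),
        ENNReal.ofReal (r ^ n) * f (r • Fin.snoc t (1 - ∑ i, t i)) := by
  set P : Set (Fin (n + 1) → ℝ) := {x | ∀ i, 0 < x i}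
  set S : Set (Fin n → ℝ) := {t | (∀ i, 0 < t i) ∧ ∑ i, t i < 1}
  have hP : MeasurableSet P := by measurability
  have hS : MeasurableSet S := by measurability
  have hg : Measurable (P.indicator f) := hf.indicator hP
  have hsnoc (t : Fin n → ℝ) (r : ℝ) (hr : 0 < r) :
      (Fin.snoc (r • t) (r - ∑ i, (r • t) i) : Fin (n + 1) → ℝ) =
        r • Fin.snoc t (1 - ∑ i, t i) := by
    ext i
    induction i using Fin.lastCases with
    | last => simp [← Finset.mul_sum, mul_sub]
    | cast i => simp
  have hmem (t : Fin n → ℝ) (r : ℝ) (hr : 0 < r) :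
      r • (Fin.snoc t (1 - ∑ i, t i) : Fin (n + 1) → ℝ) ∈ P ↔ t ∈ S := by
    simp [P, S, Fin.forall_fin_succ', hr]
  have hsum : Measurable fun y : Fin n → ℝ => ∑ i, y i := by fun_prop
  calc ∫⁻ x in P, f x = ∫⁻ y : Fin n → ℝ, ∫⁻ r : ℝ, P.indicator f (Fin.snoc y r) := by
        rw [← lintegral_indicator hP, lintegral_fin_snoc hg]
    _ = ∫⁻ y : Fin n → ℝ, ∫⁻ r : ℝ, P.indicator f (Fin.snoc y (r - ∑ i, y i)) :=
        lintegral_congr fun y =>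
          (lintegral_sub_right_eq_self (fun r => P.indicator f (Fin.snoc y r)) _).symm
    _ = ∫⁻ r : ℝ, ∫⁻ y : Fin n → ℝ, P.indicator f (Fin.snoc y (r - ∑ i, y i)) :=
        lintegral_lintegral_swap (hg.comp (measurable_fin_snoc measurable_fst
          (measurable_snd.sub (hsum.comp measurable_fst)))).aemeasurable
    _ = ∫⁻ r in Set.Ioi (0 : ℝ), ∫⁻ y : Fin n → ℝ, P.indicator f (Fin.snoc y (r - ∑ i, y i)) := by
        rw [← lintegral_indicator measurableSet_Ioi]
        refine lintegral_congr fun r => ?_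
        by_cases hr : 0 < r
        · simp [hr]
        · rw [Set.indicator_of_notMem (by simpa using hr)]
          refine lintegral_eq_zero_of_ae_eq_zero (.of_forall fun y => ?_)
          refine Set.indicator_of_notMem (fun hy => hr ?_) _
          simp only [P, Fin.forall_fin_succ', Set.mem_ofPred_eq, Fin.snoc_castSucc,
            Fin.snoc_last] at hy
          linarith [Finset.sum_nonneg fun i (_ : i ∈ Finset.univ) => (hy.1 i).le]
    _ = ∫⁻ r in Set.Ioi (0 : ℝ), ∫⁻ t in S,
          ENNReal.ofReal (r ^ n) * f (r • Fin.snoc t (1 - ∑ i, t i)) := by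
        refine setLIntegral_congr_fun measurableSet_Ioi fun r hr => ?_
        have hm : Measurable fun y : Fin n → ℝ => P.indicator f (Fin.snoc y (r - ∑ i, y i)) :=
          hg.comp (measurable_fin_snoc measurable_id (measurable_const.sub hsum))
        rw [lintegral_comp_smul_pi hm hr, Fintype.card_fin, ← lintegral_const_mul',
          ← lintegral_indicator hS]
        · refine lintegral_congr fun t => ?_
          rw [hsnoc t r hr]
          by_cases ht : t ∈ S
          · rw [Set.indicator_of_mem ht, Set.indicator_of_mem ((hmem t r hr).2 ht)]
          · rw [Set.indicator_of_notMem ht, Set.indicator_of_notMem (mt (hmem t r hr).1 ht),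
              mul_zero]
        · exact ENNReal.ofReal_ne_top
    _ = _ := by
        refine lintegral_lintegral_swap (Measurable.aemeasurable ?_)
        exact (measurable_fst.pow_const n).ennreal_ofReal.mul (hf.comp (measurable_fst.smul
          (measurable_fin_snoc measurable_snd (measurable_const.sub (hsum.comp measurable_snd)))))

/-- The Feynman parametrization of a product of inverses. -/
theorem ofReal_prod_inv_eq_lintegral_simplex {n : ℕ} {a : Fin (n + 1) → ℝ} (ha : ∀ i, 0 < a i) :
    ENNReal.ofReal (∏ i, (a i)⁻¹) = ENNReal.ofReal n.factorial *
      ∫⁻ t in {t : Fin n → ℝ | (∀ i, 0 < t i) ∧ ∑ i, t i < 1},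
        ENNReal.ofReal ((∑ i, (Fin.snoc t (1 - ∑ j, t j) : Fin (n + 1) → ℝ) i * a i) ^
          (-(n + 1 : ℝ))) := by
  rw [← lintegral_orthant_exp_neg_sum ha, lintegral_orthant_eq_lintegral_simplex (by fun_prop),
    ← lintegral_const_mul' _ _ ENNReal.ofReal_ne_top]
  refine setLIntegral_congr_fun (by measurability) fun t ht => ?_
  have hpos : 0 < ∑ i, (Fin.snoc t (1 - ∑ j, t j) : Fin (n + 1) → ℝ) i * a i := by
    refine Finset.sum_pos (fun i _ => mul_pos ?_ (ha i)) Finset.univ_nonempty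
    induction i using Fin.lastCases with
    | last => simpa using ht.2
    | cast i => simpa using ht.1 i
  rw [← ENNReal.ofReal_mul (by positivity), ← lintegral_pow_mul_exp_neg_mul_Ioi n hpos]
  refine setLIntegral_congr_fun measurableSet_Ioi fun r hr => ?_
  rw [← ENNReal.ofReal_mul (pow_nonneg (le_of_lt hr) n), Finset.sum_mul]
  congr 3
  refine congrArg Neg.neg ?_
  refine Finset.sum_congr rfl fun i _ => ?_
  rw [Pi.smul_apply, smul_eq_mul]
  ring

open scoped MatrixOrder ComplexOrder in
/-- Linear change of variables turning a positive definite quadratic form into the standard one. -/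
theorem lintegral_comp_posDef {ι : Type*} [Fintype ι] [DecidableEq ι] {N : Matrix ι ι ℝ}
    (hN : N.PosDef) {g : ℝ → ENNReal} (hg : Measurable g) :
    ∫⁻ x : ι → ℝ, g (x ⬝ᵥ N.mulVec x) =
      ENNReal.ofReal (N.det ^ (-1 / 2 : ℝ)) * ∫⁻ x : ι → ℝ, g (x ⬝ᵥ x) := by
  obtain ⟨B, hB⟩ := CStarAlgebra.nonneg_iff_eq_star_mul_self.mp hN.posSemidef.nonneg
  have hdet : N.det = B.det ^ 2 := by
    rw [hB, Matrix.det_mul, Matrix.star_eq_conjTranspose, Matrix.det_conjTranspose, star_trivial,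
      sq]
  have hB0 : B.det ≠ 0 := fun h => hN.det_pos.ne' (by simp [hdet, h])
  have hquad (x : ι → ℝ) : x ⬝ᵥ N.mulVec x = B.toLin' x ⬝ᵥ B.toLin' x := by
    rw [hB, Matrix.toLin'_apply, ← Matrix.mulVec_mulVec, Matrix.star_eq_conjTranspose,
      Matrix.dotProduct_mulVec, Matrix.vecMul_conjTranspose]
    simp
  have hmeas : Measurable fun x : ι → ℝ => g (x ⬝ᵥ x) := by
    unfold dotProduct
    fun_prop
  simp_rw [hquad]
  rw [← lintegral_map hmeas B.toLin'.continuous_on_pi.measurable,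
    Real.map_matrix_volume_pi_eq_smul_volume_pi hB0, lintegral_smul_measure, smul_eq_mul, hdet,
    ← sq_abs, ← Real.rpow_natCast, ← Real.rpow_mul (abs_nonneg _)]
  norm_num [Real.rpow_neg_one, abs_inv]

theorem lintegral_add_dotProduct_self_rpow {ι : Type*} [Fintype ι] {c : ℝ} (hc : 0 < c) (p : ℝ) :
    ∫⁻ x : ι → ℝ, ENNReal.ofReal ((c + x ⬝ᵥ x) ^ p) =
      ENNReal.ofReal (c ^ ((Fintype.card ι : ℝ) / 2 + p)) *
        ∫⁻ x : ι → ℝ, ENNReal.ofReal ((1 + x ⬝ᵥ x) ^ p) := by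
  have hmeas : Measurable fun x : ι → ℝ => ENNReal.ofReal ((c + x ⬝ᵥ x) ^ p) := by
    unfold dotProduct
    fun_prop
  have hscale (x : ι → ℝ) : (c + (√c • x) ⬝ᵥ (√c • x)) ^ p = c ^ p * (1 + x ⬝ᵥ x) ^ p := by
    have hx : 0 ≤ x ⬝ᵥ x := Finset.sum_nonneg fun i _ => mul_self_nonneg (x i)
    rw [← Real.mul_rpow hc.le (add_nonneg zero_le_one hx), smul_dotProduct,
      dotProduct_smul, smul_smul, Real.mul_self_sqrt hc.le, smul_eq_mul, mul_add, mul_one]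
  rw [lintegral_comp_smul_pi hmeas (Real.sqrt_pos.2 hc)]
  simp_rw [hscale, ENNReal.ofReal_mul (Real.rpow_nonneg hc.le p)]
  rw [lintegral_const_mul' _ _ ENNReal.ofReal_ne_top, ← mul_assoc,
    ← ENNReal.ofReal_mul (by positivity), Real.rpow_add hc, Real.sqrt_eq_rpow,
    ← Real.rpow_natCast, ← Real.rpow_mul hc.le, one_div_mul_eq_div]

theorem volume_preserving_curry (ι κ : Type*) [Fintype ι] [Fintype κ] :
    MeasurePreserving (MeasurableEquiv.curry ι κ ℝ) := by
  refine MeasurePreserving.symm (MeasurableEquiv.curry ι κ ℝ).symm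
    ⟨(MeasurableEquiv.curry ι κ ℝ).symm.measurable, (Measure.pi_eq fun s _ => ?_).symm⟩
  have hpre : (MeasurableEquiv.curry ι κ ℝ).symm ⁻¹' Set.univ.pi s =
      Set.univ.pi fun i => Set.univ.pi fun j => s (i, j) := by
    ext; simp [Function.uncurry]
  rw [MeasurableEquiv.map_apply, hpre, volume_pi_pi, Fintype.prod_prod_type]
  simp_rw [volume_pi_pi]

theorem lintegral_pi_euclideanSpace {ι κ : Type*} [Fintype ι] [Fintype κ]
    {f : (ι → EuclideanSpace ℝ κ) → ENNReal} (hf : Measurable f) :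
    ∫⁻ s, f s = ∫⁻ x : ι × κ → ℝ, f fun i => WithLp.toLp 2 fun j => x (i, j) :=
  (((volume_preserving_pi fun _ : ι => PiLp.volume_preserving_toLp κ).comp
    (volume_preserving_curry ι κ)).lintegral_comp hf).symm

theorem lintegral_one_add_norm_sq_rpow {ι κ : Type*} [Fintype ι] [Fintype κ] (e : ι ≃ κ) (p : ℝ) :
    ∫⁻ x : EuclideanSpace ℝ κ, ENNReal.ofReal ((1 + ‖x‖ ^ 2) ^ p) =
      ∫⁻ x : ι → ℝ, ENNReal.ofReal ((1 + x ⬝ᵥ x) ^ p) := by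
  have h := (PiLp.volume_preserving_toLp κ).comp
    (volume_measurePreserving_piCongrLeft (fun _ : κ => ℝ) e)
  rw [← h.lintegral_comp (by fun_prop)]
  refine lintegral_congr fun x => ?_
  rw [EuclideanSpace.real_norm_sq_eq, ← e.sum_comp]
  simp [dotProduct, MeasurableEquiv.coe_piCongrLeft, sq]

/-- The open and closed standard simplices differ by a null set. -/
theorem simplex_ae_eq {n : ℕ} :
    {t : Fin n → ℝ | (∀ i, 0 < t i) ∧ ∑ i, t i < 1} =ᵐ[volume]
      {t : Fin n → ℝ | (∀ i, 0 ≤ t i) ∧ ∑ i, t i ≤ 1} := by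
  have hsum : ∀ᵐ t : Fin n → ℝ, ∑ i, t i ≠ 1 := by
    rcases n with _ | n
    · simp
    let L : (Fin (n + 1) → ℝ) →ₗ[ℝ] ℝ := ∑ i, LinearMap.proj i
    have hL : Function.Surjective L := fun y => ⟨Pi.single 0 y, by simp [L]⟩
    simpa [L] using (ae_comp_linearMap_mem_iff L volume volume hL
      (measurableSet_singleton (1 : ℝ)).compl).2 (by simp [ae_iff])
  have hne : ∀ᵐ t : Fin n → ℝ, ∀ i, t i ≠ 0 :=
    ae_all_iff.2 fun i => Measure.ae_eval_ne (fun _ => volume) i 0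
  filter_upwards [hsum, hne] with t h1 h0
  refine propext ⟨fun h => ⟨fun i => (h.1 i).le, h.2.le⟩,
    fun h => ⟨fun i => (h.1 i).lt_of_ne' (h0 i), h.2.lt_of_ne h1⟩⟩

open scoped Kronecker in
theorem dotProduct_kronecker_one_mulVec {ι l κ : Type*} [Fintype ι] [Fintype l] [Fintype κ]
    [DecidableEq κ] (η : Matrix ι l ℝ) (τ : ι → ℝ) (x : l × κ → ℝ) :
    x ⬝ᵥ ((Matrix.of fun k r : l => ∑ i, τ i * η i k * η i r) ⊗ₖ (1 : Matrix κ κ ℝ)).mulVec x =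
      ∑ i, τ i * ∑ d, (∑ k, η i k * x (k, d)) ^ 2 := by
  simp only [dotProduct, Matrix.mulVec, Fintype.sum_prod_type, Matrix.kroneckerMap_apply,
    Matrix.of_apply, Matrix.one_apply, mul_ite, mul_one, mul_zero, ite_mul, zero_mul,
    Finset.sum_ite_eq, Finset.mem_univ, if_true, sq, Finset.mul_sum, Finset.sum_mul]
  calc _ = ∑ k, ∑ d, ∑ i, ∑ r, x (k, d) * (τ i * η i k * η i r * x (r, d)) :=
        Finset.sum_congr rfl fun k _ => Finset.sum_congr rfl fun d _ => Finset.sum_comm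
    _ = ∑ k, ∑ i, ∑ d, ∑ r, x (k, d) * (τ i * η i k * η i r * x (r, d)) :=
        Finset.sum_congr rfl fun k _ => Finset.sum_comm
    _ = ∑ i, ∑ k, ∑ d, ∑ r, x (k, d) * (τ i * η i k * η i r * x (r, d)) := Finset.sum_comm
    _ = ∑ i, ∑ d, ∑ k, ∑ r, x (k, d) * (τ i * η i k * η i r * x (r, d)) :=
        Finset.sum_congr rfl fun i _ => Finset.sum_comm
    _ = ∑ i, ∑ d, ∑ r, ∑ k, x (k, d) * (τ i * η i k * η i r * x (r, d)) :=
        Finset.sum_congr rfl fun i _ => Finset.sum_congr rfl fun d _ => Finset.sum_comm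
    _ = _ := by
        refine Finset.sum_congr rfl fun i _ => Finset.sum_congr rfl fun d _ =>
          Finset.sum_congr rfl fun r _ => Finset.sum_congr rfl fun k _ => ?_
        ring

theorem norm_sq_add_sum_smul_of_smul_eq_zero {E l : Type*} [NormedAddCommGroup E]
    [InnerProductSpace ℝ E] [Fintype l] {u : E} {a : l → ℝ} (h : ∀ k, a k • u = 0) (s : l → E) :
    ‖u + ∑ k, a k • s k‖ ^ 2 = ‖u‖ ^ 2 + ‖∑ k, a k • s k‖ ^ 2 := by
  have horth : inner ℝ u (∑ k, a k • s k) = 0 := by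
    rw [inner_sum]
    refine Finset.sum_eq_zero fun k _ => ?_
    rw [real_inner_smul_right, ← real_inner_smul_left, h k, inner_zero_left]
  rw [norm_add_sq_real, horth]
  ring

open scoped Kronecker in
/-- The integral of a power of `c` plus the quadratic form `M(τ)` on `(ℝ^κ)^l`. -/
theorem lintegral_add_quadraticForm_rpow {ι l κ : Type*} [Fintype ι] [Fintype l] [Fintype κ]
    [DecidableEq l] {η : Matrix ι l ℝ} {τ : ι → ℝ}
    (hM : (Matrix.of fun k r : l => ∑ i, τ i * η i k * η i r).PosDef) {c : ℝ} (hc : 0 < c)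
    (p : ℝ) :
    ∫⁻ s : l → EuclideanSpace ℝ κ,
        ENNReal.ofReal ((c + ∑ i, τ i * ‖∑ k, η i k • s k‖ ^ 2) ^ p) =
      ENNReal.ofReal ((Matrix.of fun k r : l => ∑ i, τ i * η i k * η i r).det ^
          (-(Fintype.card κ : ℝ) / 2) * c ^ ((Fintype.card κ * Fintype.card l : ℝ) / 2 + p)) *
        ∫⁻ x : l × κ → ℝ, ENNReal.ofReal ((1 + x ⬝ᵥ x) ^ p) := by
  classical
  have hquad (x : l × κ → ℝ) :
      ∑ i, τ i * ‖∑ k, η i k • WithLp.toLp 2 fun d => x (k, d)‖ ^ 2 =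
        x ⬝ᵥ ((Matrix.of fun k r : l => ∑ i, τ i * η i k * η i r) ⊗ₖ
          (1 : Matrix κ κ ℝ)).mulVec x := by
    rw [dotProduct_kronecker_one_mulVec]
    simp [EuclideanSpace.real_norm_sq_eq]
  rw [lintegral_pi_euclideanSpace (by fun_prop)]
  simp_rw [hquad]
  rw [lintegral_comp_posDef (hM.kronecker Matrix.PosDef.one)
      (g := fun y => ENNReal.ofReal ((c + y) ^ p)) (by fun_prop),
    lintegral_add_dotProduct_self_rpow hc, ← mul_assoc, ← ENNReal.ofReal_mul
      (Real.rpow_nonneg (hM.kronecker Matrix.PosDef.one).posSemidef.det_nonneg _),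
    Matrix.det_kronecker, Matrix.det_one, one_pow, mul_one, ← Real.rpow_natCast,
    ← Real.rpow_mul hM.posSemidef.det_nonneg, Fintype.card_prod, Nat.cast_mul]
  congr 4
  · ring
  · ring

/-- The Feynman integral as a parametric integral (Euclidean convergent version of
Corollary 3.3 of the paper, for `n + 1` edges and `ℓ` loops with `n + 1 > Dℓ/2`):
`∫_{(ℝ^D)^ℓ} ∏_i (‖u_i + Σ_k η_{ik} s_k‖² + m_i²)^{-1} ds
  = n! · C_{Dℓ,n+1} · ∫_{Σ_n} det(M(t))^{-D/2} (Σ_i t_i (‖u_i‖² + m_i²))^{Dℓ/2-(n+1)} dt`,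
where `t_{n+1} := 1 - (t_1 + ⋯ + t_n)` and `C_{Dℓ,n+1} = ∫_{ℝ^{Dℓ}} (1+‖x‖²)^{-(n+1)} dx`. -/
theorem feynman_integral_as_period (D n l : ℕ) (hD : 1 ≤ D) (hl : 1 ≤ l)
    (hconv : (D * l : ℝ) / 2 < n + 1)
    (η : Matrix (Fin (n + 1)) (Fin l) ℝ)
    (m : Fin (n + 1) → ℝ) (u : Fin (n + 1) → EuclideanSpace ℝ (Fin D))
    (hu : ∀ i k, η i k • u i = 0)
    (hpos : ∀ i, 0 < ‖u i‖ ^ 2 + m i ^ 2)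
    (hM : ∀ t : Fin (n + 1) → ℝ, (∀ i, 0 < t i) → ∑ i, t i = 1 →
      (Matrix.of fun k r : Fin l => ∑ i, t i * η i k * η i r).PosDef) :
    ∫ s : Fin l → EuclideanSpace ℝ (Fin D),
        ∏ i, (‖u i + ∑ k, η i k • s k‖ ^ 2 + m i ^ 2)⁻¹ =
      (n.factorial : ℝ) *
        (∫ x : EuclideanSpace ℝ (Fin (D * l)), (1 + ‖x‖ ^ 2) ^ (-(n + 1 : ℝ))) *
        ∫ t in {t : Fin n → ℝ | (∀ i, 0 ≤ t i) ∧ ∑ i, t i ≤ 1},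
          (Matrix.of fun k r : Fin l =>
              ∑ i, (Fin.snoc t (1 - ∑ j, t j) : Fin (n + 1) → ℝ) i * η i k * η i r).det
              ^ (-(D : ℝ) / 2) *
            (∑ i, (Fin.snoc t (1 - ∑ j, t j) : Fin (n + 1) → ℝ) i *
                (‖u i‖ ^ 2 + m i ^ 2)) ^ ((D * l : ℝ) / 2 - (n + 1)) := by
  set S : Set (Fin n → ℝ) := {t | (∀ i, 0 < t i) ∧ ∑ i, t i < 1}
  have hS : MeasurableSet S := by measurability
  set τ : (Fin n → ℝ) → Fin (n + 1) → ℝ := fun t => Fin.snoc t (1 - ∑ j, t j)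
  have hτmeas : Measurable τ := measurable_fin_snoc measurable_id (by fun_prop)
  have hτpos {t : Fin n → ℝ} (ht : t ∈ S) (i : Fin (n + 1)) : 0 < τ t i := by
    induction i using Fin.lastCases with
    | last => simpa [τ] using ht.2
    | cast i => simpa [τ] using ht.1 i
  have hτsum (t : Fin n → ℝ) : ∑ i, τ t i = 1 := by simp [τ, Fin.sum_univ_castSucc]
  set M : (Fin n → ℝ) → Matrix (Fin l) (Fin l) ℝ := fun t =>
    Matrix.of fun k r => ∑ i, τ t i * η i k * η i r
  set c : Fin (n + 1) → ℝ := fun i => ‖u i‖ ^ 2 + m i ^ 2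
  have hMpos {t : Fin n → ℝ} (ht : t ∈ S) : (M t).PosDef := hM (τ t) (hτpos ht) (hτsum t)
  have hcpos {t : Fin n → ℝ} (ht : t ∈ S) : 0 < ∑ i, τ t i * c i :=
    Finset.sum_pos (fun i _ => mul_pos (hτpos ht i) (hpos i)) Finset.univ_nonempty
  have hτi (i : Fin (n + 1)) : Measurable fun t => τ t i := measurable_pi_iff.1 hτmeas i
  have hdet : Measurable fun t => (M t).det := by
    simp only [Matrix.det_apply, M, Matrix.of_apply]
    fun_prop
  set W : (Fin n → ℝ) → ℝ := fun t =>
    (M t).det ^ (-(D : ℝ) / 2) * (∑ i, τ t i * c i) ^ ((D * l : ℝ) / 2 - (n + 1))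
  have hW : Measurable W := by fun_prop
  set A : (Fin l → EuclideanSpace ℝ (Fin D)) → Fin (n + 1) → ℝ := fun s i =>
    ‖u i + ∑ k, η i k • s k‖ ^ 2 + m i ^ 2
  have hA (s : Fin l → EuclideanSpace ℝ (Fin D)) (i : Fin (n + 1)) :
      A s i = c i + ‖∑ k, η i k • s k‖ ^ 2 := by
    simp only [A, c, norm_sq_add_sum_smul_of_smul_eq_zero (hu i)]
    ring
  have hApos (s : Fin l → EuclideanSpace ℝ (Fin D)) (i : Fin (n + 1)) : 0 < A s i := by
    rw [hA]
    exact add_pos_of_pos_of_nonneg (hpos i) (sq_nonneg _)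
  have hAmeas (i : Fin (n + 1)) : Measurable fun s => A s i := by fun_prop
  have hlhs : ∫⁻ s, ENNReal.ofReal (∏ i, (A s i)⁻¹) =
      ENNReal.ofReal n.factorial * ((∫⁻ t in S, ENNReal.ofReal (W t)) *
        ∫⁻ x : Fin l × Fin D → ℝ, ENNReal.ofReal ((1 + x ⬝ᵥ x) ^ (-(n + 1 : ℝ)))) := by
    simp_rw [fun s => ofReal_prod_inv_eq_lintegral_simplex (hApos s)]
    rw [lintegral_const_mul' _ _ ENNReal.ofReal_ne_top, lintegral_lintegral_swap,
      ← lintegral_mul_const _ hW.ennreal_ofReal]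
    · congr 1
      refine setLIntegral_congr_fun hS fun t ht => ?_
      have h := lintegral_add_quadraticForm_rpow (κ := Fin D) (hMpos ht) (hcpos ht)
        (-(n + 1 : ℝ))
      simp only [Fintype.card_fin, ← sub_eq_add_neg] at h
      rw [← h]
      refine lintegral_congr fun s => ?_
      simp only [hA, mul_add, Finset.sum_add_distrib, τ]
    · refine Measurable.aemeasurable (Measurable.ennreal_ofReal (Measurable.pow_const ?_ _))
      exact Finset.measurable_sum _ fun i _ =>
        ((hτi i).comp measurable_snd).mul ((hAmeas i).comp measurable_fst)
  have hconst : ∫ x : EuclideanSpace ℝ (Fin (D * l)), (1 + ‖x‖ ^ 2) ^ (-(n + 1 : ℝ)) =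
      (∫⁻ x : Fin l × Fin D → ℝ, ENNReal.ofReal ((1 + x ⬝ᵥ x) ^ (-(n + 1 : ℝ)))).toReal := by
    rw [integral_eq_lintegral_of_nonneg_ae (.of_forall fun x => by positivity)
        (Measurable.aestronglyMeasurable (by fun_prop)),
      lintegral_one_add_norm_sq_rpow ((Equiv.prodComm _ _).trans finProdFinEquiv)]
  have hsimplex : ∫ t in {t : Fin n → ℝ | (∀ i, 0 ≤ t i) ∧ ∑ i, t i ≤ 1}, W t =
      (∫⁻ t in S, ENNReal.ofReal (W t)).toReal := by
    rw [← setIntegral_congr_set simplex_ae_eq,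
      integral_eq_lintegral_of_nonneg_ae _ hW.aestronglyMeasurable]
    filter_upwards [ae_restrict_mem hS] with t ht
    exact mul_nonneg (Real.rpow_nonneg (hMpos ht).posSemidef.det_nonneg _)
      (Real.rpow_nonneg (hcpos ht).le _)
  change ∫ s, ∏ i, (A s i)⁻¹ = _ * _ * ∫ t in _, W t
  rw [hconst, hsimplex, integral_eq_lintegral_of_nonneg_ae
      (.of_forall fun s => Finset.prod_nonneg fun i _ => (inv_pos.2 (hApos s i)).le)
      (Measurable.aestronglyMeasurable (by fun_prop)), hlhs, ENNReal.toReal_mul,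
    ENNReal.toReal_mul, ENNReal.toReal_ofReal (Nat.cast_nonneg _)]
  ring
end
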